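/- Let d ≥ 2 and let t be an integer with 1 ≤ t ≤ d−1. Let u_1, …, u_d, v_1, …, v_d ∈ ℝ[x] be nonconstant monic polynomials of degree at most δ. Suppose there exists a subset I ⊆ {1, …, d} with |I| = t such that u_i ≢_m v_i for every i ∈ I. Then there exists a constant c > 0 depending only on δ, d and t such that for all n ∈ ℕ and all finite sets A_1, …, A_d ⊂ ℝ with |A_i| = n for each i, |u_1(A_1) · … · u_d(A_d)| · |v_1(A_1) · … · v_d(A_d)| ≥ c · n^{3 − 1/2^t}, where u_1(A_1) · … · u_d(A_d) := {u_1(a_1) · … · u_d(a_d) : a_i ∈ A_i for each i} and similarly for the v_i. -/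

import Mathlib

open Polynomial Pointwise

noncomputable section

/-- `p ≡_m q` : there is a positive rational `κ` with `|p(x)| = |q(x)|^κ` for all real `x`. -/
def EquivM (p q : Polynomial ℝ) : Prop :=
  ∃ k : ℚ, 0 < k ∧ ∀ x : ℝ, |p.eval x| = |q.eval x| ^ (k : ℝ)

open Filter Topology in
theorem aux_reverse_tendsto (u : ℂ[X]) (hu : u.Monic) (z : ℕ → ℂ)
    (hz : Tendsto (fun k => ‖z k‖) atTop atTop) :
    Tendsto (fun k => u.eval (z k) / z k ^ u.natDegree) atTop (𝓝 1) := by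
  have h1 : Tendsto (fun k => (z k)⁻¹) atTop (𝓝 0) :=
    tendsto_inv₀_cobounded.comp (tendsto_norm_atTop_iff_cobounded.mp hz)
  have h2 : Tendsto (fun k => u.reverse.eval (z k)⁻¹) atTop (𝓝 (u.reverse.eval 0)) :=
    (u.reverse.continuous.tendsto 0).comp h1
  have h3 : u.reverse.eval 0 = 1 := by
    rw [← coeff_zero_eq_eval_zero, coeff_zero_reverse, hu.leadingCoeff]
  rw [h3] at h2
  refine h2.congr' ?_
  filter_upwards [hz.eventually_gt_atTop 0] with k hk
  have hk0 : z k ≠ 0 := by simpa using hk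
  let _ := invertibleOfNonzero hk0
  have := eval₂_reverse_mul_pow (RingHom.id ℂ) (z k) u
  simp only [eval₂_id, invOf_eq_inv] at this
  rw [← this]
  field_simp

open Filter Topology in
theorem aux_orbit (u v : ℂ[X]) (hu : u.Monic) (hv : v.Monic) (hu0 : 0 < u.natDegree)
    (α β : ℂ) (hα : 1 < ‖α‖)
    (H : ∀ x : ℂ, ∃ y : ℂ, u.eval y = α * u.eval x ∧ v.eval y = β * v.eval x) :
    u ^ v.natDegree = v ^ u.natDegree := by
  choose h hhu hhv using H
  set p := u.natDegree with hp
  set q := v.natDegree with hq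
  have key : ∀ x : ℂ, u.eval x ≠ 0 → u.eval x ^ q = v.eval x ^ p := by
    intro x hx
    set z : ℕ → ℂ := fun k => h^[k] x with hz
    have hzs : ∀ k, z (k+1) = h (z k) := fun k => Function.iterate_succ_apply' h k x
    have hzu : ∀ k, u.eval (z k) = α ^ k * u.eval x := by
      intro k
      induction k with
      | zero => simp [hz]
      | succ k ih => rw [hzs, hhu, ih]; ring
    have hzn : Tendsto (fun k => ‖z k‖) atTop atTop := by
      have h1 : Tendsto (fun k => ‖u.eval (z k)‖) atTop atTop := by
        simp only [hzu, norm_mul, norm_pow]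
        exact (tendsto_pow_atTop_atTop_of_one_lt hα).atTop_mul_const (norm_pos_iff.mpr hx)
      rw [tendsto_norm_atTop_iff_cobounded, Metric.cobounded_eq_cocompact] at h1 ⊢
      refine (tendsto_comap_iff (g := fun w => eval w u)).mpr h1 |>.mono_right ?_
      exact comap_cocompact_le u.continuous
    have tu := aux_reverse_tendsto u hu z hzn
    have tv := aux_reverse_tendsto v hv z hzn
    have tr : Tendsto (fun k => u.eval (z k) ^ q / v.eval (z k) ^ p) atTop (𝓝 1) := by
      have := (tu.pow q).div (tv.pow p) (by simp)
      simp only [one_pow, div_one] at this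
      refine this.congr' ?_
      filter_upwards [hzn.eventually_gt_atTop 0] with k hk
      have hk0 : z k ≠ 0 := by simpa using hk
      rw [Pi.div_apply]
      simp only [div_pow, ← pow_mul, ← hp, ← hq, mul_comm p q]
      exact div_div_div_cancel_right₀ (pow_ne_zero _ hk0) _ _
    have ts : ∀ k, u.eval (z (k+1)) ^ q / v.eval (z (k+1)) ^ p =
        (α ^ q / β ^ p) * (u.eval (z k) ^ q / v.eval (z k) ^ p) := by
      intro k
      rw [hzs, hhu, hhv, mul_pow, mul_pow, mul_div_mul_comm]
    have tr1 := (tendsto_add_atTop_iff_nat 1).mpr tr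
    simp only [ts] at tr1
    have e := tendsto_nhds_unique tr1 (tr.const_mul _)
    rw [mul_one] at e
    simp only [← e, one_mul] at ts
    have tc : ∀ k, u.eval (z k) ^ q / v.eval (z k) ^ p = u.eval x ^ q / v.eval x ^ p := by
      intro k
      induction k with
      | zero => simp [hz]
      | succ k ih => rw [ts, ih]
    simp only [tc] at tr
    have e2 := tendsto_nhds_unique tr tendsto_const_nhds
    have hv0 : v.eval x ^ p ≠ 0 := by
      intro h0
      rw [h0] at e2
      simp at e2
    exact (div_eq_one_iff_eq hv0).mp e2.symm
  have : u * (u ^ q - v ^ p) = 0 := by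
    apply Polynomial.funext
    intro x
    by_cases hx : u.eval x = 0
    · simp [hx]
    · simp [key x hx]
  rcases mul_eq_zero.mp this with h0 | h0
  · exact absurd h0 hu.ne_zero
  · exact sub_eq_zero.mp h0

theorem aux_equivM (u v : ℝ[X]) (hu0 : 0 < u.natDegree) (hv0 : 0 < v.natDegree)
    (h : u ^ v.natDegree = v ^ u.natDegree) : EquivM u v := by
  refine ⟨(u.natDegree : ℚ) / v.natDegree, by positivity, fun x => ?_⟩
  have h1 := congrArg (fun w => |eval x w|) h
  simp only [eval_pow, abs_pow] at h1
  push_cast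
  rw [div_eq_mul_inv, Real.rpow_mul (abs_nonneg _), Real.rpow_natCast, ← h1,
    Real.pow_rpow_inv_natCast (abs_nonneg _) hv0.ne']

theorem aux_natDegree_det {n : ℕ} (M : Matrix (Fin n) (Fin n) ℝ[X]) (δ : ℕ)
    (h : ∀ i j, (M i j).natDegree ≤ δ) : M.det.natDegree ≤ n * δ := by
  rw [Matrix.det_apply]
  refine natDegree_sum_le_of_forall_le _ _ fun σ _ => ?_
  refine (natDegree_smul_le _ _).trans ?_
  refine (natDegree_prod_le _ _).trans ?_
  refine (Finset.sum_le_sum fun i _ => h _ i).trans ?_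
  simp

theorem aux_elim (u v : ℝ[X]) (δ : ℕ) (hu : u.Monic) (hv : v.Monic)
    (hu0 : 0 < u.natDegree) (hv0 : 0 < v.natDegree)
    (huδ : u.natDegree ≤ δ) (hvδ : v.natDegree ≤ δ) (hne : ¬ EquivM u v)
    (α β : ℝ) (hα : 1 < |α|) :
    ∃ R : ℝ[X], R ≠ 0 ∧ R.natDegree ≤ 2 * δ * δ ∧
      ∀ x y : ℝ, u.eval y = α * u.eval x → v.eval y = β * v.eval x → R.eval x = 0 := by
  set F : ℝ[X][X] := u.map C - C (C α * u) with hF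
  set G : ℝ[X][X] := v.map C - C (C β * v) with hG
  have hmapF : ∀ x : ℂ, F.map (aeval x : ℝ[X] →ₐ[ℝ] ℂ).toRingHom =
      u.map (algebraMap ℝ ℂ) - C ((α : ℂ) * (u.map (algebraMap ℝ ℂ)).eval x) := by
    intro x
    ext k
    simp [hF, aeval_def, eval_map, coeff_C]
  have hmapG : ∀ x : ℂ, G.map (aeval x : ℝ[X] →ₐ[ℝ] ℂ).toRingHom =
      v.map (algebraMap ℝ ℂ) - C ((β : ℂ) * (v.map (algebraMap ℝ ℂ)).eval x) := by
    intro x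
    ext k
    simp [hG, aeval_def, eval_map, coeff_C]
  have hres : ∀ x : ℂ, aeval x (resultant F G u.natDegree v.natDegree) = 0 ↔
      ∃ y : ℂ, (u.map (algebraMap ℝ ℂ)).eval y = (α : ℂ) * (u.map (algebraMap ℝ ℂ)).eval x ∧
        (v.map (algebraMap ℝ ℂ)).eval y = (β : ℂ) * (v.map (algebraMap ℝ ℂ)).eval x := by
    intro x
    have h1 := resultant_map_map F G u.natDegree v.natDegree
      (aeval x : ℝ[X] →ₐ[ℝ] ℂ).toRingHom
    have h2 : (aeval x : ℝ[X] →ₐ[ℝ] ℂ).toRingHom (resultant F G u.natDegree v.natDegree) =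
      aeval x (resultant F G u.natDegree v.natDegree) := rfl
    rw [h2, hmapF, hmapG] at h1
    rw [← h1]
    set f := u.map (algebraMap ℝ ℂ) - C ((α : ℂ) * (u.map (algebraMap ℝ ℂ)).eval x) with hf
    set g := v.map (algebraMap ℝ ℂ) - C ((β : ℂ) * (v.map (algebraMap ℝ ℂ)).eval x) with hg
    have hfd : f.natDegree = u.natDegree := by rw [hf, natDegree_sub_C, natDegree_map]
    have hgd : g.natDegree = v.natDegree := by rw [hg, natDegree_sub_C, natDegree_map]
    rw [← hfd, ← hgd, resultant_eq_zero_iff,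
      isCoprime_iff_aeval_ne_zero_of_isAlgClosed ℂ ℂ]
    have hf0 : f ≠ 0 := by
      rintro h; rw [h] at hfd; simp at hfd; omega
    simp only [hf0, ne_eq, not_false_eq_true, true_or, true_and, not_forall, not_or, not_not]
    simp [hf, hg, sub_eq_zero]
  refine ⟨resultant F G u.natDegree v.natDegree, ?_, ?_, ?_⟩
  · intro h0
    apply hne
    apply aux_equivM u v hu0 hv0
    apply Polynomial.map_injective (algebraMap ℝ ℂ) (algebraMap ℝ ℂ).injective
    have := aux_orbit (u.map (algebraMap ℝ ℂ)) (v.map (algebraMap ℝ ℂ)) (hu.map _) (hv.map _)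
      (by rwa [natDegree_map]) α β (by simpa using hα)
      (fun x => (hres x).mp (by rw [h0]; simp))
    simpa [Polynomial.map_pow, natDegree_map] using this
  · have hcF : ∀ k, (F.coeff k).natDegree ≤ δ := by
      intro k
      simp only [hF, coeff_sub, coeff_map, coeff_C]
      refine (natDegree_sub_le _ _).trans ?_
      split_ifs
      · have := natDegree_C_mul_le α u
        simp; omega
      · simp
    have hcG : ∀ k, (G.coeff k).natDegree ≤ δ := by
      intro k
      simp only [hG, coeff_sub, coeff_map, coeff_C]
      refine (natDegree_sub_le _ _).trans ?_
      split_ifs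
      · have := natDegree_C_mul_le β v
        simp; omega
      · simp
    refine (aux_natDegree_det _ δ ?_).trans (Nat.mul_le_mul_right _ (by omega))
    intro i j
    unfold sylvester
    induction j using Fin.addCases <;> simp only [Matrix.of_apply, Fin.addCases_left,
      Fin.addCases_right] <;> split_ifs <;> simp [hcF, hcG]
  · intro x y h1 h2
    have h3 := (hres (x : ℂ)).mpr ⟨(y : ℂ), ?_, ?_⟩
    · have h4 := aeval_algebraMap_apply_eq_algebraMap_eval (A := ℂ) x
        (resultant F G u.natDegree v.natDegree)
      have h5 : algebraMap ℝ ℂ x = (x : ℂ) := rfl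
      rw [h5, h3] at h4
      simpa using h4.symm
    · have e : ∀ t : ℝ, (u.map (algebraMap ℝ ℂ)).eval (t : ℂ) = ((u.eval t : ℝ) : ℂ) :=
        fun t => by
          have := aeval_algebraMap_apply_eq_algebraMap_eval (A := ℂ) t u
          rwa [← eval_map_algebraMap] at this
      rw [e, e, h1]; push_cast; rfl
    · have e : ∀ t : ℝ, (v.map (algebraMap ℝ ℂ)).eval (t : ℂ) = ((v.eval t : ℝ) : ℂ) :=
        fun t => by
          have := aeval_algebraMap_apply_eq_algebraMap_eval (A := ℂ) t v
          rwa [← eval_map_algebraMap] at this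
      rw [e, e, h2]; push_cast; rfl

theorem aux_mult1 (u v : ℝ[X]) (δ : ℕ) (hu : u.Monic) (hv : v.Monic)
    (hu0 : 0 < u.natDegree) (hv0 : 0 < v.natDegree)
    (huδ : u.natDegree ≤ δ) (hvδ : v.natDegree ≤ δ) (hne : ¬ EquivM u v)
    (α β : ℝ) (hα : 1 < |α|) (S : Finset (ℝ × ℝ))
    (hS : ∀ z ∈ S, u.eval z.2 = α * u.eval z.1 ∧ v.eval z.2 = β * v.eval z.1) :
    S.card ≤ 2 * δ * δ * δ := by
  classical
  obtain ⟨R, hR0, hRd, hR⟩ := aux_elim u v δ hu hv hu0 hv0 huδ hvδ hne α β hα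
  have h1 : S.card ≤ δ * R.roots.toFinset.card := by
    apply Finset.card_le_mul_card_image_of_maps_to (f := Prod.fst)
    · intro z hz
      rw [Multiset.mem_toFinset, mem_roots hR0]
      exact hR _ _ (hS z hz).1 (hS z hz).2
    · intro x _
      set w := u - C (α * u.eval x) with hw
      have hwd : w.natDegree = u.natDegree := natDegree_sub_C
      have hw0 : w ≠ 0 := by
        intro h; rw [h] at hwd; simp at hwd; omega
      have : (Finset.card {z ∈ S | z.1 = x}) ≤ w.roots.toFinset.card := by
        apply Finset.card_le_card_of_injOn Prod.snd
        · intro z hz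
          simp only [Finset.coe_filter, Set.mem_ofPred_eq] at hz
          simp only [Finset.mem_coe, Multiset.mem_toFinset, mem_roots hw0, IsRoot.def]
          rw [hw, eval_sub, eval_C, (hS z hz.1).1, hz.2, sub_self]
        · intro z hz z' hz' h
          simp only [Finset.coe_filter, Set.mem_ofPred_eq] at hz hz'
          exact Prod.ext (hz.2.trans hz'.2.symm) h
      refine this.trans ((Multiset.toFinset_card_le _).trans ((card_roots' w).trans ?_))
      omega
  have h2 : R.roots.toFinset.card ≤ 2 * δ * δ :=
    (Multiset.toFinset_card_le _).trans ((card_roots' R).trans hRd)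
  calc S.card ≤ _ := h1
    _ ≤ δ * (2 * δ * δ) := Nat.mul_le_mul_left _ h2
    _ = _ := by ring

theorem aux_mult (u v : ℝ[X]) (δ : ℕ) (hu : u.Monic) (hv : v.Monic)
    (hu0 : 0 < u.natDegree) (hv0 : 0 < v.natDegree)
    (huδ : u.natDegree ≤ δ) (hvδ : v.natDegree ≤ δ) (hne : ¬ EquivM u v)
    (α β : ℝ) (hα0 : α ≠ 0) (hβ0 : β ≠ 0) (hα : |α| ≠ 1) (S : Finset (ℝ × ℝ))
    (hS : ∀ z ∈ S, u.eval z.2 = α * u.eval z.1 ∧ v.eval z.2 = β * v.eval z.1) :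
    S.card ≤ 2 * δ * δ * δ := by
  classical
  rcases lt_or_gt_of_ne hα with h | h
  · rw [← Finset.card_image_of_injective S Prod.swap_injective]
    refine aux_mult1 u v δ hu hv hu0 hv0 huδ hvδ hne α⁻¹ β⁻¹ ?_ _ ?_
    · rw [abs_inv]
      exact (one_lt_inv₀ (abs_pos.mpr hα0)).mpr h
    · intro z hz
      obtain ⟨w, hw, rfl⟩ := Finset.mem_image.mp hz
      obtain ⟨h1, h2⟩ := hS w hw
      simp only [Prod.fst_swap, Prod.snd_swap]
      rw [h1, h2]
      constructor <;> field_simp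
  · exact aux_mult1 u v δ hu hv hu0 hv0 huδ hvδ hne α β h S hS

open Classical in
/-- Pairs of points of `X` with few points of `X` in between. -/
def closePairs (X : Finset ℝ) (m : ℕ) : Finset (ℝ × ℝ) :=
  (X ×ˢ X).filter fun z => z.1 ≠ z.2 ∧
    (X.filter fun t => t ∈ Set.uIoc z.1 z.2).card * m ≤ 4 * X.card

theorem aux_rank (W : Finset ℝ) (N : ℝ → ℕ) (T : ℕ) (hN : ∀ x ∈ W, 1 ≤ N x ∧ N x ≤ T)
    (hinj : ∀ x ∈ W, ∀ y ∈ W, x < y → N x ≠ N y) : W.card ≤ T := by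
  have : W.card ≤ (Finset.Icc 1 T).card := by
    apply Finset.card_le_card_of_injOn N
    · intro x hx
      simpa using hN x hx
    · intro x hx y hy h
      by_contra hne
      rcases lt_or_gt_of_ne hne with h1 | h1
      · exact hinj x hx y hy h1 h
      · exact hinj y hy x hx h1 h.symm
  simpa using this

theorem closePairs_card (X : Finset ℝ) (m : ℕ) (hm : 0 < m) :
    (closePairs X m).card * m ≤ 8 * X.card ^ 2 := by
  classical
  set T := 4 * X.card / m with hT
  have h1 : (closePairs X m).card ≤ (2 * T) * X.card := by
    apply Finset.card_le_mul_card_image_of_maps_to (f := Prod.fst)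
    · intro z hz
      simp only [closePairs, Finset.mem_filter, Finset.mem_product] at hz
      exact hz.1.1
    · intro x hx
      have hup : (X.filter fun y => x < y ∧
          (X.filter fun t => t ∈ Set.uIoc x y).card * m ≤ 4 * X.card).card ≤ T := by
        apply aux_rank _ (fun y => (X.filter fun t => t ∈ Set.uIoc x y).card)
        · intro y hy
          simp only [Finset.mem_filter] at hy
          refine ⟨Finset.card_pos.mpr ⟨y, ?_⟩, (Nat.le_div_iff_mul_le hm).mpr hy.2.2⟩
          simp [Set.uIoc_of_le hy.2.1.le, hy.1, hy.2.1]
        · intro y hy y' hy' hlt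
          simp only [Finset.mem_filter] at hy hy'
          apply ne_of_lt
          apply Finset.card_lt_card
          rw [Finset.ssubset_iff_of_subset]
          · refine ⟨y', ?_, ?_⟩
            · simp [Set.uIoc_of_le hy'.2.1.le, hy'.1, hy'.2.1]
            · simp [Set.uIoc_of_le hy.2.1.le, hlt]
          · intro t
            simp only [Finset.mem_filter, Set.uIoc_of_le hy.2.1.le, Set.uIoc_of_le hy'.2.1.le,
              Set.mem_Ioc]
            rintro ⟨a, b, c⟩
            exact ⟨a, b, c.trans hlt.le⟩
      have hdn : (X.filter fun y => y < x ∧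
          (X.filter fun t => t ∈ Set.uIoc x y).card * m ≤ 4 * X.card).card ≤ T := by
        apply aux_rank _ (fun y => (X.filter fun t => t ∈ Set.uIoc x y).card)
        · intro y hy
          simp only [Finset.mem_filter] at hy
          refine ⟨Finset.card_pos.mpr ⟨x, ?_⟩, (Nat.le_div_iff_mul_le hm).mpr hy.2.2⟩
          simp [Set.uIoc_of_ge hy.2.1.le, hx, hy.2.1]
        · intro y hy y' hy' hlt
          simp only [Finset.mem_filter] at hy hy'
          apply ne_of_gt
          apply Finset.card_lt_card
          rw [Finset.ssubset_iff_of_subset]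
          · refine ⟨y', ?_, ?_⟩
            · simp [Set.uIoc_of_ge hy.2.1.le, hy'.1, hy'.2.1.le, hlt]
            · simp [Set.uIoc_of_ge hy'.2.1.le]
          · intro t
            simp only [Finset.mem_filter, Set.uIoc_of_ge hy.2.1.le, Set.uIoc_of_ge hy'.2.1.le,
              Set.mem_Ioc]
            rintro ⟨a, b, c⟩
            exact ⟨a, hlt.trans b, c⟩
      have hle : (Finset.card {z ∈ closePairs X m | z.1 = x}) ≤
          ((X.filter fun y => x < y ∧
            (X.filter fun t => t ∈ Set.uIoc x y).card * m ≤ 4 * X.card) ∪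
          (X.filter fun y => y < x ∧
            (X.filter fun t => t ∈ Set.uIoc x y).card * m ≤ 4 * X.card)).card := by
        apply Finset.card_le_card_of_injOn Prod.snd
        · rintro ⟨a, b⟩ hz
          simp only [closePairs, Finset.coe_filter, Set.mem_ofPred_eq, Finset.mem_filter,
            Finset.mem_product] at hz
          obtain ⟨⟨⟨ha, hb⟩, hne, hc⟩, rfl⟩ := hz
          simp only [Finset.coe_union, Finset.coe_filter, Set.mem_union, Set.mem_ofPred_eq]
          rcases lt_or_gt_of_ne hne with h | h
          · exact Or.inl ⟨hb, h, hc⟩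
          · exact Or.inr ⟨hb, h, hc⟩
        · intro z hz z' hz' h
          simp only [Finset.coe_filter, Set.mem_ofPred_eq] at hz hz'
          exact Prod.ext (hz.2.trans hz'.2.symm) h
      have := Finset.card_union_le (X.filter fun y => x < y ∧
            (X.filter fun t => t ∈ Set.uIoc x y).card * m ≤ 4 * X.card)
          (X.filter fun y => y < x ∧
            (X.filter fun t => t ∈ Set.uIoc x y).card * m ≤ 4 * X.card)
      omega
  have h2 : T * m ≤ 4 * X.card := Nat.div_mul_le_self _ _
  calc (closePairs X m).card * m ≤ (2 * T) * X.card * m := Nat.mul_le_mul_right _ h1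
    _ = 2 * X.card * (T * m) := by ring
    _ ≤ 2 * X.card * (4 * X.card) := Nat.mul_le_mul_left _ h2
    _ = _ := by ring

theorem closePairs_many (X : Finset ℝ) (m : ℕ) (w : ℕ → ℝ)
    (hw : StrictMonoOn w (Set.Iic m) ∨ StrictAntiOn w (Set.Iic m))
    (hX : ∀ i ≤ m, w i ∈ X) :
    3 * m ≤ 4 * ((Finset.range m).filter fun i => (w i, w (i + 1)) ∈ closePairs X m).card := by
  classical
  set E : ℕ → Finset ℝ := fun i => X.filter fun t => t ∈ Set.uIoc (w i) (w (i + 1)) with hE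
  have hdisj : ∀ i j, i < j → j < m → Disjoint (E i) (E j) := by
    intro i j hij hj
    rw [Finset.disjoint_left]
    intro t ht ht'
    simp only [hE, Finset.mem_filter] at ht ht'
    rcases hw with hw | hw
    · have h1 : w i < w (i+1) := hw (by simp; omega) (by simp; omega) (by omega)
      have h2 : w j < w (j+1) := hw (by simp; omega) (by simp; omega) (by omega)
      have h3 : w (i+1) ≤ w j := hw.monotoneOn (by simp; omega) (by simp; omega) (by omega)
      rw [Set.uIoc_of_le h1.le] at ht
      rw [Set.uIoc_of_le h2.le] at ht'
      have := ht.2.2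
      have := ht'.2.1
      linarith
    · have h1 : w (i+1) < w i := hw (by simp; omega) (by simp; omega) (by omega)
      have h2 : w (j+1) < w j := hw (by simp; omega) (by simp; omega) (by omega)
      have h3 : w j ≤ w (i+1) := hw.antitoneOn (by simp; omega) (by simp; omega) (by omega)
      rw [Set.uIoc_of_ge h1.le] at ht
      rw [Set.uIoc_of_ge h2.le] at ht'
      have := ht.2.1
      have := ht'.2.2
      linarith
  have hsum : ∑ i ∈ Finset.range m, (E i).card ≤ X.card := by
    rw [← Finset.card_biUnion]
    · apply Finset.card_le_card
      intro t ht
      obtain ⟨i, _, hi⟩ := Finset.mem_biUnion.mp ht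
      exact (Finset.mem_filter.mp hi).1
    · intro i hi j hj hne
      simp only [Finset.coe_range, Set.mem_Iio, Finset.mem_coe] at hi hj
      rcases lt_or_gt_of_ne hne with h | h
      · exact hdisj i j h hj
      · exact (hdisj j i h hi).symm
  have hXpos : 0 < X.card := Finset.card_pos.mpr ⟨w 0, hX 0 (Nat.zero_le _)⟩
  have hbad : 4 * ((Finset.range m).filter fun i => ¬ (w i, w (i + 1)) ∈ closePairs X m).card
      ≤ m := by
    set Bd := (Finset.range m).filter fun i => ¬ (w i, w (i + 1)) ∈ closePairs X m with hBd
    have h1 : Bd.card * (4 * X.card) ≤ ∑ i ∈ Bd, (E i).card * m := by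
      rw [← smul_eq_mul, ← Finset.sum_const]
      apply Finset.sum_le_sum
      intro i hi
      simp only [hBd, closePairs, Finset.mem_filter, Finset.mem_range, Finset.mem_product,
        not_and] at hi
      have hne : w i ≠ w (i+1) := by
        rcases hw with hw | hw
        · exact (hw (by simp; omega) (by simp; omega) (by omega : i < i + 1)).ne
        · exact (hw (by simp; omega) (by simp; omega) (by omega : i < i + 1)).ne'
      have := hi.2 ⟨hX i (by omega), hX (i+1) (by omega)⟩ hne
      exact (not_le.mp this).le
    have h2 : ∑ i ∈ Bd, (E i).card * m ≤ X.card * m := by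
      rw [← Finset.sum_mul]
      refine Nat.mul_le_mul_right _ (le_trans ?_ hsum)
      exact Finset.sum_le_sum_of_subset (Finset.filter_subset _ _)
    have h3 := h1.trans h2
    have h4 : X.card * (4 * Bd.card) ≤ X.card * m := by linarith
    exact Nat.le_of_mul_le_mul_left h4 hXpos
  have := Finset.card_filter_add_card_filter_not (s := Finset.range m)
    (fun i => (w i, w (i + 1)) ∈ closePairs X m)
  rw [Finset.card_range] at this
  omega

theorem aux_comb (m K : ℕ) (hm : 0 < m) (s r : ℕ → ℝ)
    (hs : StrictMonoOn s (Set.Iic m) ∨ StrictAntiOn s (Set.Iic m))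
    (hr : StrictMonoOn r (Set.Iic m) ∨ StrictAntiOn r (Set.Iic m))
    (hs0 : ∀ i ≤ m, s i ≠ 0) (hr0 : ∀ i ≤ m, r i ≠ 0)
    (hK : ∀ α β : ℝ,
      ((Finset.range m).filter fun i => s (i + 1) = α * s i ∧ r (i + 1) = β * r i).card ≤ K)
    (B C X Y : Finset ℝ) (hB : ∀ b ∈ B, b ≠ 0) (hC : ∀ c ∈ C, c ≠ 0)
    (hX : ∀ i ≤ m, ∀ b ∈ B, s i * b ∈ X) (hY : ∀ i ≤ m, ∀ c ∈ C, r i * c ∈ Y) :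
    m ^ 3 * (B.card * C.card) ≤ 128 * K * (X.card * Y.card) ^ 2 := by
  classical
  have hmul : ∀ (f : ℕ → ℝ) (b : ℝ), b ≠ 0 →
      (StrictMonoOn f (Set.Iic m) ∨ StrictAntiOn f (Set.Iic m)) →
      (StrictMonoOn (fun i => f i * b) (Set.Iic m) ∨
        StrictAntiOn (fun i => f i * b) (Set.Iic m)) := by
    intro f b hb hf
    rcases lt_or_gt_of_ne hb with h | h <;> rcases hf with hf | hf
    · exact Or.inr fun i hi j hj hij => mul_lt_mul_of_neg_right (hf hi hj hij) h
    · exact Or.inl fun i hi j hj hij => mul_lt_mul_of_neg_right (hf hi hj hij) h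
    · exact Or.inl fun i hi j hj hij => mul_lt_mul_of_pos_right (hf hi hj hij) h
    · exact Or.inr fun i hi j hj hij => mul_lt_mul_of_pos_right (hf hi hj hij) h
  set good : ℝ × ℝ → Finset ℕ := fun bc => (Finset.range m).filter fun i =>
    (s i * bc.1, s (i + 1) * bc.1) ∈ closePairs X m ∧
    (r i * bc.2, r (i + 1) * bc.2) ∈ closePairs Y m with hgood
  have hg : ∀ bc ∈ B ×ˢ C, m ≤ 2 * (good bc).card := by
    rintro ⟨b, c⟩ hbc
    obtain ⟨hb, hc⟩ := Finset.mem_product.mp hbc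
    have h1 := closePairs_many X m (fun i => s i * b) (hmul s b (hB b hb) hs)
      (fun i hi => hX i hi b hb)
    have h2 := closePairs_many Y m (fun i => r i * c) (hmul r c (hC c hc) hr)
      (fun i hi => hY i hi c hc)
    have h3 := Finset.card_inter_add_card_union
      ((Finset.range m).filter fun i => (s i * b, s (i + 1) * b) ∈ closePairs X m)
      ((Finset.range m).filter fun i => (r i * c, r (i + 1) * c) ∈ closePairs Y m)
    have h4 : (((Finset.range m).filter fun i => (s i * b, s (i + 1) * b) ∈ closePairs X m) ∪
      ((Finset.range m).filter fun i => (r i * c, r (i + 1) * c) ∈ closePairs Y m)).card ≤ m := by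
      conv_rhs => rw [← Finset.card_range m]
      exact Finset.card_le_card (Finset.union_subset (Finset.filter_subset _ _)
        (Finset.filter_subset _ _))
    rw [← Finset.filter_and] at h3
    simp only [hgood]
    omega
  set T : Finset (Σ _ : ℝ × ℝ, ℕ) := (B ×ˢ C).sigma good with hT
  have hTcard : m * (B.card * C.card) ≤ 2 * T.card := by
    rw [hT, Finset.card_sigma, Finset.mul_sum, ← Finset.card_product, mul_comm, ← smul_eq_mul,
      ← Finset.sum_const]
    exact Finset.sum_le_sum hg
  have hTup : T.card ≤ K * (closePairs X m ×ˢ closePairs Y m).card := by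
    apply Finset.card_le_mul_card_image_of_maps_to
      (f := fun z : (Σ _ : ℝ × ℝ, ℕ) => ((s z.2 * z.1.1, s (z.2 + 1) * z.1.1),
        (r z.2 * z.1.2, r (z.2 + 1) * z.1.2)))
    · rintro ⟨⟨b, c⟩, i⟩ hz
      simp only [hT, hgood, Finset.mem_sigma, Finset.mem_filter] at hz
      exact Finset.mem_product.mpr hz.2.2
    · rintro ⟨⟨x, x'⟩, ⟨y, y'⟩⟩ _
      refine le_trans ?_ (hK (x' / x) (y' / y))
      apply Finset.card_le_card_of_injOn Sigma.snd
      · rintro ⟨⟨b, c⟩, i⟩ hz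
        simp only [hT, hgood, Finset.coe_filter, Set.mem_ofPred_eq, Finset.mem_sigma,
          Finset.mem_filter, Finset.mem_product, Finset.mem_range, Prod.mk.injEq] at hz
        obtain ⟨⟨⟨hb, hc⟩, hi, _⟩, ⟨rfl, rfl⟩, ⟨rfl, rfl⟩⟩ := hz
        simp only [Finset.coe_filter, Set.mem_ofPred_eq, Finset.mem_range]
        have h1 := hs0 i hi.le
        have h2 := hr0 i hi.le
        have h3 := hB b hb
        have h4 := hC c hc
        refine ⟨hi, ?_, ?_⟩ <;> field_simp
      · rintro ⟨⟨b, c⟩, i⟩ hz ⟨⟨b', c'⟩, i'⟩ hz' h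
        simp only [hT, hgood, Finset.coe_filter, Set.mem_ofPred_eq, Finset.mem_sigma,
          Finset.mem_filter, Finset.mem_product, Finset.mem_range, Prod.mk.injEq] at hz hz' h
        subst h
        obtain ⟨⟨⟨hb, hc⟩, hi, _⟩, ⟨e1, _⟩, ⟨e2, _⟩⟩ := hz
        obtain ⟨_, ⟨e3, _⟩, ⟨e4, _⟩⟩ := hz'
        have h1 := mul_left_cancel₀ (hs0 i hi.le) (e1.trans e3.symm)
        have h2 := mul_left_cancel₀ (hr0 i hi.le) (e2.trans e4.symm)
        rw [h1, h2]
  have hQX := closePairs_card X m hm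
  have hQY := closePairs_card Y m hm
  rw [Finset.card_product] at hTup
  calc m ^ 3 * (B.card * C.card) = m ^ 2 * (m * (B.card * C.card)) := by ring
    _ ≤ m ^ 2 * (2 * (K * ((closePairs X m).card * (closePairs Y m).card))) :=
        Nat.mul_le_mul_left _ (hTcard.trans (Nat.mul_le_mul_left _ hTup))
    _ = 2 * K * (((closePairs X m).card * m) * ((closePairs Y m).card * m)) := by ring
    _ ≤ 2 * K * ((8 * X.card ^ 2) * (8 * Y.card ^ 2)) :=
        Nat.mul_le_mul_left _ (Nat.mul_le_mul hQX hQY)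
    _ = _ := by ring

theorem aux_injOn (p : ℝ[X]) (lo hi : ℝ)
    (h : ∀ z ∈ Set.Icc lo hi, p.derivative.eval z ≠ 0) :
    Set.InjOn (fun x => p.eval x) (Set.Icc lo hi) := by
  have key : ∀ x ∈ Set.Icc lo hi, ∀ y ∈ Set.Icc lo hi, x < y → p.eval x ≠ p.eval y := by
    intro x hx y hy hxy he
    obtain ⟨c, hc, hc'⟩ := exists_deriv_eq_zero hxy p.continuous.continuousOn he
    rw [Polynomial.deriv] at hc'
    exact h c ⟨hx.1.trans hc.1.le, hc.2.le.trans hy.2⟩ hc'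
  intro x hx y hy he
  by_contra hne
  rcases lt_or_gt_of_ne hne with h1 | h1
  · exact key x hx y hy h1 he
  · exact key y hy x hx h1 he.symm

theorem aux_step (u v : ℝ[X]) (δ : ℕ) (hu : u.Monic) (hv : v.Monic)
    (hu0 : 0 < u.natDegree) (hv0 : 0 < v.natDegree)
    (huδ : u.natDegree ≤ δ) (hvδ : v.natDegree ≤ δ) (hne : ¬ EquivM u v)
    (n : ℕ) (hn : 8 * δ + 4 ≤ n) (A B C X Y : Finset ℝ) (hA : A.card = n)
    (hB : ∀ b ∈ B, b ≠ 0) (hC : ∀ c ∈ C, c ≠ 0)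
    (hX : ∀ a ∈ A, u.eval a ≠ 0 → ∀ b ∈ B, u.eval a * b ∈ X)
    (hY : ∀ a ∈ A, v.eval a ≠ 0 → ∀ c ∈ C, v.eval a * c ∈ Y) :
    n ^ 3 * (B.card * C.card) ≤
      ((16 * δ + 8) ^ 3 * (128 * (2 * δ * δ * δ))) * (X.card * Y.card) ^ 2 := by
  classical
  set W := (u * u.derivative) * (v * v.derivative) with hW
  have hud : u.derivative ≠ 0 := fun h => by
    have := derivative_eq_zero.mp h; omega
  have hvd : v.derivative ≠ 0 := fun h => by
    have := derivative_eq_zero.mp h; omega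
  have hW0 : W ≠ 0 := mul_ne_zero (mul_ne_zero hu.ne_zero hud) (mul_ne_zero hv.ne_zero hvd)
  set Z := W.roots.toFinset with hZ
  have hZmem : ∀ z, z ∉ Z → u.eval z ≠ 0 ∧ u.derivative.eval z ≠ 0 ∧ v.eval z ≠ 0 ∧
      v.derivative.eval z ≠ 0 := by
    intro z hz
    rw [hZ, Multiset.mem_toFinset, mem_roots hW0, IsRoot.def, hW] at hz
    simp only [eval_mul, mul_eq_zero, not_or] at hz
    tauto
  have hZc : Z.card ≤ 4 * δ := by
    refine (Multiset.toFinset_card_le _).trans ((card_roots' W).trans ?_)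
    rw [hW]
    have h1 := natDegree_mul_le (p := u * u.derivative) (q := v * v.derivative)
    have h2 := natDegree_mul_le (p := u) (q := u.derivative)
    have h3 := natDegree_mul_le (p := v) (q := v.derivative)
    have h4 := natDegree_derivative_le u
    have h5 := natDegree_derivative_le v
    omega
  set m := n / (8 * δ + 4) with hm
  have hm0 : 0 < m := Nat.div_pos hn (by omega)
  have hm1 : m * (8 * δ + 4) ≤ n := Nat.div_mul_le_self _ _
  have hm2 : n ≤ (16 * δ + 8) * m := by
    have h1 := Nat.lt_mul_div_succ n (by omega : 0 < 8 * δ + 4)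
    rw [← hm] at h1
    nlinarith
  have hAZ : n ≤ (A \ Z).card + 4 * δ := by
    have := Finset.le_card_sdiff Z A
    omega
  set f : ℝ → ℕ := fun a => (Z.filter fun z => z < a).card with hf
  obtain ⟨k, _, hk⟩ := Finset.exists_lt_card_fiber_of_mul_lt_card_of_maps_to
    (s := A \ Z) (t := Finset.range (4 * δ + 1)) (f := f) (n := m)
    (by
      intro a _
      rw [Finset.mem_range]
      have := Finset.card_filter_le Z (fun z => z < a)
      simp only [hf]
      omega)
    (by
      rw [Finset.card_range]
      nlinarith)
  set D := {x ∈ A \ Z | f x = k} with hD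
  have hDmem : ∀ x ∈ D, x ∈ A ∧ x ∉ Z ∧ f x = k := by
    intro x hx
    simp only [hD, Finset.mem_filter, Finset.mem_sdiff] at hx
    tauto
  set a : ℕ → ℝ := fun i => if h : i < D.card then D.orderEmbOfFin rfl ⟨i, h⟩ else 0 with ha
  have haD : ∀ i ≤ m, a i ∈ D := by
    intro i hi
    have : i < D.card := by omega
    simp only [ha, this, dif_pos]
    exact Finset.orderEmbOfFin_mem _ _ _
  have hamono : StrictMonoOn a (Set.Iic m) := by
    intro i hi j hj hij
    simp only [Set.mem_Iic] at hi hj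
    have h1 : i < D.card := by omega
    have h2 : j < D.card := by omega
    simp only [ha, h1, h2, dif_pos]
    exact (D.orderEmbOfFin rfl).strictMono (by simpa using hij)
  have haI : ∀ i ≤ m, a i ∈ Set.Icc (a 0) (a m) := by
    intro i hi
    exact ⟨hamono.monotoneOn (by simp) (by simpa using hi) (Nat.zero_le _),
      hamono.monotoneOn (by simpa using hi) (by simp) hi⟩
  have hIZ : ∀ z ∈ Set.Icc (a 0) (a m), z ∉ Z := by
    intro z hz hzZ
    have h0 := hDmem _ (haD 0 (Nat.zero_le _))
    have h1 := hDmem _ (haD m le_rfl)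
    have hlt : f (a 0) < f (a m) := by
      apply Finset.card_lt_card
      rw [Finset.ssubset_iff_of_subset]
      · refine ⟨z, ?_, ?_⟩
        · rw [Finset.mem_filter]
          refine ⟨hzZ, lt_of_le_of_ne hz.2 ?_⟩
          rintro rfl
          exact h1.2.1 hzZ
        · rw [Finset.mem_filter]
          rintro ⟨_, h⟩
          exact absurd hz.1 (not_le.mpr h)
      · intro t
        simp only [Finset.mem_filter]
        rintro ⟨h, h'⟩
        exact ⟨h, h'.trans_le (hz.1.trans hz.2)⟩
    omega
  have hle : a 0 ≤ a m := (haI 0 (Nat.zero_le _)).2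
  have hmono : ∀ p : ℝ[X], (∀ z ∈ Set.Icc (a 0) (a m), p.derivative.eval z ≠ 0) →
      StrictMonoOn (fun i => p.eval (a i)) (Set.Iic m) ∨
      StrictAntiOn (fun i => p.eval (a i)) (Set.Iic m) := by
    intro p hp
    have h1 := ContinuousOn.strictMonoOn_of_injOn_Icc' hle p.continuous.continuousOn
      (aux_injOn p _ _ hp)
    rcases h1 with h1 | h1
    · exact Or.inl fun i hi j hj hij => h1 (haI i hi) (haI j hj) (hamono hi hj hij)
    · exact Or.inr fun i hi j hj hij => h1 (haI i hi) (haI j hj) (hamono hi hj hij)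
  have hsq : Set.InjOn (fun x => (u ^ 2).eval x) (Set.Icc (a 0) (a m)) := by
    apply aux_injOn
    intro z hz
    have := hZmem z (hIZ z hz)
    simp only [derivative_pow, eval_mul, eval_pow, eval_C]
    simp [this.1, this.2.1]
  have hai : ∀ i ≤ m, u.eval (a i) ≠ 0 ∧ v.eval (a i) ≠ 0 := by
    intro i hi
    have := hZmem _ (hIZ _ (haI i hi))
    tauto
  have main := aux_comb m (2 * δ * δ * δ) hm0 (fun i => u.eval (a i)) (fun i => v.eval (a i))
    (hmono u fun z hz => (hZmem z (hIZ z hz)).2.1)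
    (hmono v fun z hz => (hZmem z (hIZ z hz)).2.2.2)
    (fun i hi => (hai i hi).1) (fun i hi => (hai i hi).2)
    (by
      intro α β
      set S := ((Finset.range m).filter fun i => u.eval (a (i + 1)) = α * u.eval (a i) ∧
        v.eval (a (i + 1)) = β * v.eval (a i)) with hS
      rcases S.eq_empty_or_nonempty with h | ⟨i, hi⟩
      · rw [h]; simp
      · simp only [hS, Finset.mem_filter, Finset.mem_range] at hi
        obtain ⟨him, e1, e2⟩ := hi
        have hα0 : α ≠ 0 := by
          rintro rfl; rw [zero_mul] at e1; exact (hai (i + 1) him).1 e1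
        have hβ0 : β ≠ 0 := by
          rintro rfl; rw [zero_mul] at e2; exact (hai (i + 1) him).2 e2
        have hα1 : |α| ≠ 1 := by
          intro h1
          have h2 : α ^ 2 = 1 := by rw [← sq_abs, h1, one_pow]
          have h3 : (u ^ 2).eval (a (i + 1)) = (u ^ 2).eval (a i) := by
            rw [eval_pow, eval_pow, e1, mul_pow, h2, one_mul]
          have h4 := hsq (haI _ him) (haI _ him.le) h3
          have h5 : a i < a (i + 1) := hamono (by simpa using him.le)
            (by simpa using him) (by omega)
          exact h5.ne' h4
        have h6 : S.card = (S.image fun i => (a i, a (i + 1))).card := by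
          rw [Finset.card_image_of_injOn]
          intro i hi j hj hij
          simp only [hS, Finset.coe_filter, Set.mem_ofPred_eq, Finset.mem_range] at hi hj
          simp only [Prod.mk.injEq] at hij
          exact hamono.injOn (by simpa using hi.1.le) (by simpa using hj.1.le) hij.1
        rw [h6]
        apply aux_mult u v δ hu hv hu0 hv0 huδ hvδ hne α β hα0 hβ0 hα1
        intro z hz
        obtain ⟨j, hj, rfl⟩ := Finset.mem_image.mp hz
        simp only [hS, Finset.mem_filter] at hj
        exact hj.2)
    B C X Y hB hC
    (fun i hi b hb => hX _ (hDmem _ (haD i hi)).1 (hai i hi).1 b hb)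
    (fun i hi c hc => hY _ (hDmem _ (haD i hi)).1 (hai i hi).2 c hc)
  calc n ^ 3 * (B.card * C.card) ≤ ((16 * δ + 8) * m) ^ 3 * (B.card * C.card) := by gcongr
    _ = (16 * δ + 8) ^ 3 * (m ^ 3 * (B.card * C.card)) := by ring
    _ ≤ (16 * δ + 8) ^ 3 * (128 * (2 * δ * δ * δ) * (X.card * Y.card) ^ 2) :=
      Nat.mul_le_mul_left _ main
    _ = _ := by ring

/-- Nonzero values of the partial products. -/
def prodSet {d : ℕ} (u : Fin d → ℝ[X]) (A : Fin d → Finset ℝ) (S : Finset (Fin d)) : Finset ℝ :=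
  ((Fintype.piFinset A).image fun a => ∏ i ∈ S, (u i).eval (a i)).erase 0

theorem prodSet_mul {d : ℕ} (u : Fin d → ℝ[X]) (A : Fin d → Finset ℝ) (S : Finset (Fin d))
    (j : Fin d) (hj : j ∉ S) (a : ℝ) (ha : a ∈ A j) (ha0 : (u j).eval a ≠ 0) (b : ℝ)
    (hb : b ∈ prodSet u A S) : (u j).eval a * b ∈ prodSet u A (insert j S) := by
  classical
  simp only [prodSet, Finset.mem_erase, Finset.mem_image, Fintype.mem_piFinset] at hb ⊢
  obtain ⟨hb0, f, hf, rfl⟩ := hb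
  refine ⟨mul_ne_zero ha0 hb0, Function.update f j a, ?_, ?_⟩
  · intro i
    by_cases h : i = j
    · subst h; simpa using ha
    · simpa [h] using hf i
  · rw [Finset.prod_insert hj]
    congr 1
    · simp
    · apply Finset.prod_congr rfl
      intro i hi
      have : i ≠ j := by rintro rfl; exact hj hi
      simp [this]

theorem aux_exists_nonroot (p : ℝ[X]) (δ : ℕ) (hp : p.Monic) (hpδ : p.natDegree ≤ δ)
    (A : Finset ℝ) (hA : δ < A.card) : ∃ a ∈ A, p.eval a ≠ 0 := by
  classical
  by_contra! h
  have : A.card ≤ p.roots.toFinset.card := by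
    apply Finset.card_le_card
    intro a ha
    rw [Multiset.mem_toFinset, mem_roots hp.ne_zero]
    exact h a ha
  have h2 := (Multiset.toFinset_card_le p.roots).trans (card_roots' p)
  omega

theorem prodSet_mono {d : ℕ} (u : Fin d → ℝ[X]) (A : Fin d → Finset ℝ) (S : Finset (Fin d))
    (h : ∀ j, ∃ a ∈ A j, (u j).eval a ≠ 0) (T : Finset (Fin d)) :
    (prodSet u A S).card ≤ (prodSet u A (T ∪ S)).card := by
  classical
  induction T using Finset.induction_on with
  | empty => simp
  | insert j T hj ih =>
    refine ih.trans ?_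
    rw [Finset.insert_union]
    by_cases hjS : j ∈ T ∪ S
    · rw [Finset.insert_eq_of_mem hjS]
    · obtain ⟨a, ha, ha0⟩ := h j
      apply Finset.card_le_card_of_injOn (fun b => (u j).eval a * b)
      · intro b hb
        exact prodSet_mul u A _ j hjS a ha ha0 b hb
      · intro b _ b' _ hbb
        exact mul_left_cancel₀ ha0 hbb

theorem prodSet_single {d : ℕ} (u : Fin d → ℝ[X]) (A : Fin d → Finset ℝ) (j : Fin d) (δ n : ℕ)
    (hu0 : 0 < (u j).natDegree) (huδ : (u j).natDegree ≤ δ)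
    (hA : ∀ i, (A i).card = n) (hn : 2 * δ ≤ n) :
    n ≤ 2 * δ * (prodSet u A {j}).card := by
  classical
  have hne : u j ≠ 0 := by rintro h; rw [h] at hu0; simp at hu0
  set A' := (A j).filter fun a => (u j).eval a ≠ 0 with hA'
  have h1 : A'.card ≤ δ * (prodSet u A {j}).card := by
    apply Finset.card_le_mul_card_image_of_maps_to (f := fun a => (u j).eval a)
    · intro a ha
      simp only [hA', Finset.mem_filter] at ha
      simp only [prodSet, Finset.mem_erase, Finset.mem_image, Fintype.mem_piFinset,
        Finset.prod_singleton]
      have hne' : ∀ i, (A i).Nonempty := by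
        intro i
        rw [← Finset.card_pos, hA i]
        omega
      choose g hg using hne'
      refine ⟨ha.2, Function.update g j a, ?_, by simp⟩
      intro i
      by_cases h : i = j
      · subst h; simpa using ha.1
      · simpa [h] using hg i
    · intro y _
      set w := u j - Polynomial.C y with hw
      have hwd : w.natDegree = (u j).natDegree := natDegree_sub_C
      have hw0 : w ≠ 0 := by
        intro h; rw [h] at hwd; simp at hwd; omega
      have : (Finset.card {a ∈ A' | (u j).eval a = y}) ≤ w.roots.toFinset.card := by
        apply Finset.card_le_card
        intro a ha
        simp only [Finset.mem_filter] at ha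
        rw [Multiset.mem_toFinset, mem_roots hw0, IsRoot.def, hw, eval_sub, eval_C, ha.2, sub_self]
      refine this.trans ((Multiset.toFinset_card_le _).trans ((card_roots' w).trans ?_))
      omega
  have h2 : ((A j).filter fun a => ¬ (u j).eval a ≠ 0).card ≤ δ := by
    have : ((A j).filter fun a => ¬ (u j).eval a ≠ 0).card ≤ (u j).roots.toFinset.card := by
      apply Finset.card_le_card
      intro a ha
      simp only [Finset.mem_filter, not_not] at ha
      rw [Multiset.mem_toFinset, mem_roots hne]
      exact ha.2
    refine this.trans ((Multiset.toFinset_card_le _).trans ((card_roots' _).trans huδ))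
  have h3 := Finset.card_filter_add_card_filter_not (s := A j) (fun a => (u j).eval a ≠ 0)
  rw [hA j] at h3
  have h4 : n ≤ 2 * A'.card := by simp only [hA']; omega
  nlinarith

theorem aux_induct (d δ : ℕ) (hδ : 1 ≤ δ) (t : ℕ) :
    ∃ c : ℝ, 0 < c ∧
      ∀ u v : Fin d → Polynomial ℝ,
        (∀ i, 0 < (u i).natDegree) → (∀ i, 0 < (v i).natDegree) →
        (∀ i, (u i).natDegree ≤ δ) → (∀ i, (v i).natDegree ≤ δ) →
        (∀ i, (u i).Monic) → (∀ i, (v i).Monic) →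
        ∀ I : Finset (Fin d), I.card = t → (∀ i ∈ I, ¬ EquivM (u i) (v i)) →
        ∀ i0 ∉ I,
        ∀ (n : ℕ) (A : Fin d → Finset ℝ), 8 * δ + 4 ≤ n → (∀ i, (A i).card = n) →
          c * (n : ℝ) ^ ((3 : ℝ) - 1 / 2 ^ t) ≤
            ((prodSet u A (insert i0 I)).card : ℝ) * ((prodSet v A (insert i0 I)).card : ℝ) := by
  classical
  induction t with
  | zero =>
    refine ⟨1 / (2 * δ) ^ 2, by positivity, ?_⟩
    intro u v hu0 hv0 huδ hvδ hu hv I hI _ i0 _ n A hn hA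
    have hI' : I = ∅ := Finset.card_eq_zero.mp hI
    subst hI'
    have h1 := prodSet_single u A i0 δ n (hu0 i0) (huδ i0) hA (by omega)
    have h2 := prodSet_single v A i0 δ n (hv0 i0) (hvδ i0) hA (by omega)
    have h3 := Nat.mul_le_mul h1 h2
    have h4 : (n : ℝ) * n ≤ (2 * δ * (prodSet u A {i0}).card) * (2 * δ * (prodSet v A {i0}).card) :=
      by exact_mod_cast h3
    have e : (3 : ℝ) - 1 / 2 ^ 0 = (2 : ℕ) := by norm_num
    rw [e, Real.rpow_natCast, one_div, inv_mul_le_iff₀ (by positivity)]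
    simp only [insert_empty_eq]
    nlinarith
  | succ t ih =>
    obtain ⟨c, hc, ih⟩ := ih
    set K : ℝ := (((16 * δ + 8) ^ 3 * (128 * (2 * δ * δ * δ)) : ℕ) : ℝ) with hK
    have hK0 : 0 < K := by
      rw [hK]; positivity
    refine ⟨Real.sqrt (c / K), Real.sqrt_pos.mpr (by positivity), ?_⟩
    intro u v hu0 hv0 huδ hvδ hu hv I hI hE i0 hi0 n A hn hA
    obtain ⟨j, hj⟩ : I.Nonempty := by rw [← Finset.card_pos]; omega
    have hIj : (I.erase j).card = t := by rw [Finset.card_erase_of_mem hj]; omega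
    have hi0' : i0 ∉ I.erase j := fun h => hi0 (Finset.mem_of_mem_erase h)
    have h1 := ih u v hu0 hv0 huδ hvδ hu hv (I.erase j) hIj
      (fun i hi => hE i (Finset.mem_of_mem_erase hi)) i0 hi0' n A hn hA
    set S := insert i0 (I.erase j) with hS
    have hjS : j ∉ S := by
      rw [hS, Finset.mem_insert]
      rintro (rfl | h)
      · exact hi0 hj
      · simp at h
    have hins : insert i0 I = insert j S := by
      rw [hS, Finset.insert_comm, Finset.insert_erase hj]
    rw [hins]
    have h2 := aux_step (u j) (v j) δ (hu j) (hv j) (hu0 j) (hv0 j) (huδ j) (hvδ j) (hE j hj)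
      n hn (A j) (prodSet u A S) (prodSet v A S) (prodSet u A (insert j S))
      (prodSet v A (insert j S)) (hA j)
      (fun b hb => Finset.ne_of_mem_erase hb) (fun b hb => Finset.ne_of_mem_erase hb)
      (fun a ha ha0 b hb => prodSet_mul u A S j hjS a ha ha0 b hb)
      (fun a ha ha0 b hb => prodSet_mul v A S j hjS a ha ha0 b hb)
    set P : ℝ := ((prodSet u A (insert j S)).card : ℝ) * ((prodSet v A (insert j S)).card : ℝ)
      with hP
    set P0 : ℝ := ((prodSet u A S).card : ℝ) * ((prodSet v A S).card : ℝ) with hP0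
    have h3 : (n : ℝ) ^ 3 * P0 ≤ K * P ^ 2 := by
      rw [hP, hP0, hK]
      exact_mod_cast h2
    have hn0 : (0 : ℝ) < n := by
      have : 0 < n := by omega
      exact_mod_cast this
    have hPn : 0 ≤ P := by positivity
    refine (sq_le_sq₀ (by positivity) hPn).mp ?_
    rw [mul_pow, Real.sq_sqrt (by positivity), ← Real.rpow_natCast (_ ^ _), ← Real.rpow_mul hn0.le]
    have e : ((3 : ℝ) - 1 / 2 ^ (t + 1)) * (2 : ℕ) = (3 : ℕ) + (3 - 1 / 2 ^ t) := by
      push_cast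
      rw [pow_succ]
      field_simp
      ring
    rw [e, Real.rpow_add hn0, Real.rpow_natCast, div_mul_eq_mul_div, div_le_iff₀ hK0]
    calc c * ((n : ℝ) ^ 3 * (n : ℝ) ^ ((3 : ℝ) - 1 / 2 ^ t))
        = (n : ℝ) ^ 3 * (c * (n : ℝ) ^ ((3 : ℝ) - 1 / 2 ^ t)) := by ring
      _ ≤ (n : ℝ) ^ 3 * P0 := by gcongr
      _ ≤ K * P ^ 2 := h3
      _ = P ^ 2 * K := by ring

theorem stmt17 (d t δ : ℕ) (hd : 2 ≤ d) (ht1 : 1 ≤ t) (ht2 : t ≤ d - 1) :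
    ∃ c : ℝ, 0 < c ∧
      ∀ u v : Fin d → Polynomial ℝ,
        (∀ i, 0 < (u i).natDegree) → (∀ i, 0 < (v i).natDegree) →
        (∀ i, (u i).natDegree ≤ δ) → (∀ i, (v i).natDegree ≤ δ) →
        (∀ i, (u i).Monic) → (∀ i, (v i).Monic) →
        (∃ I : Finset (Fin d), I.card = t ∧ ∀ i ∈ I, ¬ EquivM (u i) (v i)) →
        ∀ (n : ℕ) (A : Fin d → Finset ℝ), (∀ i, (A i).card = n) →
          c * (n : ℝ) ^ ((3 : ℝ) - 1 / 2 ^ t) ≤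
            (((Fintype.piFinset A).image fun a => ∏ i, (u i).eval (a i)).card : ℝ) *
            (((Fintype.piFinset A).image fun a => ∏ i, (v i).eval (a i)).card : ℝ) := by
  classical
  rcases Nat.eq_zero_or_pos δ with h0 | hδ
  · refine ⟨1, one_pos, ?_⟩
    intro u v hu0 _ huδ
    have h1 := hu0 ⟨0, by omega⟩
    have h2 := huδ ⟨0, by omega⟩
    omega
  obtain ⟨c, hc, H⟩ := aux_induct d δ hδ t
  set N : ℝ := ((8 * δ + 4 : ℕ) : ℝ) with hN
  have hN0 : 0 < N := by rw [hN]; positivity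
  have hpow : (1 : ℝ) / 2 ^ t ≤ 1 := by
    rw [div_le_one (by positivity)]
    exact one_le_pow₀ (by norm_num)
  have hexp : (0 : ℝ) < (3 : ℝ) - 1 / 2 ^ t := by linarith
  refine ⟨min c (1 / N ^ ((3 : ℝ) - 1 / 2 ^ t)), lt_min hc (by positivity), ?_⟩
  intro u v hu0 hv0 huδ hvδ hu hv hI n A hA
  obtain ⟨I, hIt, hI⟩ := hI
  rcases Nat.eq_zero_or_pos n with hn0 | hnpos
  · subst hn0
    rw [Nat.cast_zero, Real.zero_rpow hexp.ne', mul_zero]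
    positivity
  rcases lt_or_ge n (8 * δ + 4) with hn | hn
  · have hne : (Fintype.piFinset A).Nonempty := by
      rw [Fintype.piFinset_nonempty]
      intro i
      rw [← Finset.card_pos, hA i]
      exact hnpos
    have h1 : (1 : ℝ) ≤ ((Fintype.piFinset A).image fun a => ∏ i, (u i).eval (a i)).card := by
      exact_mod_cast Finset.card_pos.mpr (hne.image _)
    have h2 : (1 : ℝ) ≤ ((Fintype.piFinset A).image fun a => ∏ i, (v i).eval (a i)).card := by
      exact_mod_cast Finset.card_pos.mpr (hne.image _)
    have h3 : (n : ℝ) ^ ((3 : ℝ) - 1 / 2 ^ t) ≤ N ^ ((3 : ℝ) - 1 / 2 ^ t) := by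
      apply Real.rpow_le_rpow (by positivity) _ hexp.le
      rw [hN]
      exact_mod_cast hn.le
    calc _ ≤ 1 / N ^ ((3 : ℝ) - 1 / 2 ^ t) * N ^ ((3 : ℝ) - 1 / 2 ^ t) := by
          apply mul_le_mul (min_le_right _ _) h3 (by positivity) (by positivity)
      _ = 1 := by
          have : 0 < N ^ ((3 : ℝ) - 1 / 2 ^ t) := by positivity
          field_simp
      _ ≤ _ := one_le_mul_of_one_le_of_one_le h1 h2
  · obtain ⟨i0, hi0⟩ : ∃ i0, i0 ∉ I := by
      by_contra! h
      have : I = Finset.univ := Finset.eq_univ_iff_forall.mpr h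
      rw [this, Finset.card_univ, Fintype.card_fin] at hIt
      omega
    have h1 := H u v hu0 hv0 huδ hvδ hu hv I hIt hI i0 hi0 n A hn hA
    have hcard : ∀ w : Fin d → ℝ[X], (∀ i, (w i).natDegree ≤ δ) → (∀ i, (w i).Monic) →
        ((prodSet w A (insert i0 I)).card : ℝ) ≤
        (((Fintype.piFinset A).image fun a => ∏ i, (w i).eval (a i)).card : ℝ) := by
      intro w hwδ hw
      have h2 := prodSet_mono w A (insert i0 I)
        (fun j => aux_exists_nonroot (w j) δ (hw j) (hwδ j) (A j) (by rw [hA j]; omega))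
        Finset.univ
      rw [Finset.union_eq_left.mpr (Finset.subset_univ _)] at h2
      have h3 : (prodSet w A Finset.univ).card ≤
          ((Fintype.piFinset A).image fun a => ∏ i, (w i).eval (a i)).card :=
        Finset.card_erase_le
      exact_mod_cast h2.trans h3
    calc _ ≤ c * (n : ℝ) ^ ((3 : ℝ) - 1 / 2 ^ t) := by
          gcongr
          exact min_le_left _ _
      _ ≤ _ := h1
      _ ≤ _ := mul_le_mul (hcard u huδ hu) (hcard v hvδ hv) (by positivity) (by positivity)
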